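/- arXiv:math/0303147 — 2 statements merged into one kernel-verified Lean document; each statement's English description precedes it below -/
import Mathlib

section
/- If f and g are real polynomials all of whose complex zeros lie in the real interval [-1,0], then all complex zeros of the diamond product f ◇ g also lie in [-1,0]. -/
open Polynomial

/-- A real polynomial is `[-1,0]`-rooted if it is nonzero and all its complex zeros lie in the
real interval `[-1,0]`. -/
def IntervalRooted (f : Polynomial ℝ) : Prop :=
  f ≠ 0 ∧ ∀ z : ℂ, (f.map (algebraMap ℝ ℂ)).IsRoot z →
    z.im = 0 ∧ -1 ≤ z.re ∧ z.re ≤ 0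

/-- The diamond product `f ◇ g = Σₙ (f⁽ⁿ⁾/n!)(g⁽ⁿ⁾/n!) xⁿ(x+1)ⁿ`. -/
noncomputable def diamond (f g : Polynomial ℝ) : Polynomial ℝ :=
  ∑ n ∈ Finset.range (f.natDegree + 1),
    C (((n.factorial : ℝ) * n.factorial)⁻¹) *
      (derivative^[n] f) * (derivative^[n] g) * (X * (X + 1)) ^ n

/-- A complex polynomial is Hurwitz stable if it is nonzero and all its zeros lie in the open left
half-plane. -/
def HurwitzStable (P : ℂ[X]) : Prop :=
  P ≠ 0 ∧ ∀ t : ℂ, P.IsRoot t → t.re < 0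

namespace HurwitzStable

theorem mul {P Q : ℂ[X]} (hP : HurwitzStable P) (hQ : HurwitzStable Q) :
    HurwitzStable (P * Q) := by
  refine ⟨mul_ne_zero hP.1 hQ.1, fun t ht => ?_⟩
  rcases root_mul.mp ht with h | h
  exacts [hP.2 t h, hQ.2 t h]

theorem coeff_zero_ne_zero {P : ℂ[X]} (hP : HurwitzStable P) : P.coeff 0 ≠ 0 := by
  intro h
  have := hP.2 0 (zero_isRoot_of_coeff_zero_eq_zero h)
  simp at this

/-- By the Gauss–Lucas theorem, stability passes to the derivative. -/
theorem derivative {P : ℂ[X]} (hP : HurwitzStable P) (hdeg : 0 < P.natDegree) :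
    HurwitzStable (Polynomial.derivative P) := by
  have hne : Polynomial.derivative P ≠ 0 := fun h =>
    hdeg.ne' (Polynomial.derivative_eq_zero.mp h)
  refine ⟨hne, fun t ht => ?_⟩
  have hmem : t ∈ (Polynomial.derivative P).rootSet ℂ := by
    simpa [mem_rootSet, hne] using ht
  have hsub : P.rootSet ℂ ⊆ {w : ℂ | w.re < 0} := fun w hw =>
    hP.2 w (by simpa [mem_rootSet, hP.1] using hw)
  exact convexHull_min hsub (convex_halfSpace_re_lt 0)
    (rootSet_derivative_subset_convexHull_rootSet (natDegree_pos_iff_degree_pos.mp hdeg) hmem)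

theorem coeff_ne_zero {n : ℕ} : ∀ {P : ℂ[X]}, HurwitzStable P → n ≤ P.natDegree →
    P.coeff n ≠ 0 := by
  induction n with
  | zero => exact fun hP _ => hP.coeff_zero_ne_zero
  | succ n ih =>
    intro P hP hn h
    refine ih (hP.derivative (by omega)) ?_ (by rw [coeff_derivative, h, zero_mul])
    rw [natDegree_derivative]
    omega

theorem reverse {P : ℂ[X]} (hP : HurwitzStable P) : HurwitzStable P.reverse := by
  refine ⟨by simpa using hP.1, fun t ht => ?_⟩
  have ht0 : t ≠ 0 := by
    rintro rfl
    rw [IsRoot.def, ← coeff_zero_eq_eval_zero, coeff_zero_reverse] at ht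
    exact hP.1 (leadingCoeff_eq_zero.mp ht)
  let : Invertible t⁻¹ := invertibleOfNonzero (inv_ne_zero ht0)
  have hroot : P.IsRoot t⁻¹ := by
    have := (eval₂_reverse_eq_zero_iff (RingHom.id ℂ) t⁻¹ P).mp
      (by simpa [eval₂_id] using ht)
    simpa [eval₂_id] using this
  have := hP.2 _ hroot
  rw [Complex.inv_re] at this
  by_contra! h
  exact this.not_ge (div_nonneg h (Complex.normSq_nonneg t))

/-- The sum of the products of corresponding coefficients of two stable polynomials is a
coefficient of the stable polynomial `P.reverse * Q`, hence does not vanish. -/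
theorem sum_coeff_mul_coeff_ne_zero {P Q : ℂ[X]} (hP : HurwitzStable P) (hQ : HurwitzStable Q) :
    ∑ n ∈ Finset.range (P.natDegree + 1), P.coeff n * Q.coeff n ≠ 0 := by
  have hdeg : P.natDegree ≤ (P.reverse * Q).natDegree := by
    rw [natDegree_mul hP.reverse.1 hQ.1, reverse_natDegree,
      natTrailingDegree_eq_zero.mpr (Or.inr hP.coeff_zero_ne_zero)]
    omega
  have h := (hP.reverse.mul hQ).coeff_ne_zero hdeg
  rw [mul_comm, coeff_mul, Finset.Nat.sum_antidiagonal_eq_sum_range_succ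
    (fun i j => Q.coeff i * P.reverse.coeff j)] at h
  convert h using 1
  refine Finset.sum_congr rfl fun n hn => ?_
  have hn : n ≤ P.natDegree := by simpa [Nat.lt_succ_iff] using hn
  rw [coeff_reverse, revAt_le (Nat.sub_le _ _), Nat.sub_sub_self hn, mul_comm]

end HurwitzStable

/-- Off the interval `[-1,0]`, the quotient `z / (z + 1)` has a square root in the open right
half-plane. -/
theorem exists_sq_mul_add_one_eq {z : ℂ} (hz : ¬(z.im = 0 ∧ -1 ≤ z.re ∧ z.re ≤ 0)) :
    ∃ r : ℂ, 0 < r.re ∧ r ^ 2 * (z + 1) = z := by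
  have hz1 : z + 1 ≠ 0 := by
    intro h
    apply hz
    rw [eq_neg_of_add_eq_zero_left h]
    simp
  obtain ⟨r, hr⟩ := IsAlgClosed.exists_pow_nat_eq (z / (z + 1)) (n := 2) two_pos
  have hr' : r ^ 2 * (z + 1) = z := by rw [hr, div_mul_cancel₀ _ hz1]
  have hre : r.re ≠ 0 := by
    intro h
    apply hz
    have h1 := congrArg Complex.re hr'
    have h2 := congrArg Complex.im hr'
    simp [pow_two, h] at h1 h2
    have him : z.im = 0 := by
      have : (1 + r.im * r.im) * z.im = 0 := by linarith
      exact (mul_eq_zero.mp this).resolve_left (by nlinarith [mul_self_nonneg r.im])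
    exact ⟨him, by nlinarith [mul_self_nonneg r.im], by nlinarith [mul_self_nonneg r.im]⟩
  rcases hre.lt_or_gt with h | h
  · exact ⟨-r, by simpa using h, by rw [neg_sq, hr']⟩
  · exact ⟨r, h, hr'⟩

/-- The change of variable `t ↦ z + r (z + 1) t` moves `[-1,0]` into the open left half-plane. -/
theorem IntervalRooted.hurwitzStable {f : ℝ[X]} (hf : IntervalRooted f) {z r : ℂ}
    (hr : 0 < r.re) (hrz : r ^ 2 * (z + 1) = z) :
    HurwitzStable ((taylor z (f.map (algebraMap ℝ ℂ))).comp (C (r * (z + 1)) * X)) := by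
  have hr0 : r ≠ 0 := by
    rintro rfl
    simp at hr
  have hz1 : z + 1 ≠ 0 := by
    intro h
    rw [h, mul_zero] at hrz
    simp [← hrz] at h
  have hp : r * (z + 1) ≠ 0 := mul_ne_zero hr0 hz1
  have hf0 : f.map (algebraMap ℝ ℂ) ≠ 0 :=
    (Polynomial.map_ne_zero_iff (algebraMap ℝ ℂ).injective).mpr hf.1
  refine ⟨?_, fun t ht => ?_⟩
  · rw [Ne, comp_C_mul_X_eq_zero_iff (mem_nonZeroDivisors_of_ne_zero hp)]
    simpa using hf0
  · rw [IsRoot.def, eval_comp, taylor_eval] at ht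
    obtain ⟨him, hlo, hhi⟩ := hf.2 _ ht
    simp only [eval_mul, eval_C, eval_X] at him hlo hhi
    set θ : ℂ := r * (z + 1) * t + z with hθ
    have hθr : θ = (θ.re : ℂ) := Complex.ext rfl (by simpa using him)
    have ht : t = -((1 + θ.re : ℝ) * r + (-θ.re : ℝ) * r⁻¹) := by
      push_cast
      rw [← hθr]
      field_simp
      apply mul_right_cancel₀ hz1
      linear_combination (-1 : ℂ) * hθ + (1 + θ) * hrz
    have hinv : 0 < (r⁻¹).re := by
      rw [Complex.inv_re]
      exact div_pos hr (Complex.normSq_pos.mpr hr0)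
    rw [ht, Complex.neg_re, Complex.add_re, Complex.re_ofReal_mul, Complex.re_ofReal_mul]
    nlinarith [mul_nonneg (by linarith : 0 ≤ 1 + θ.re) hr.le,
      mul_nonneg (by linarith : 0 ≤ -θ.re) hinv.le]

theorem eval_map_iterate_derivative (f : ℝ[X]) (n : ℕ) (z : ℂ) :
    ((Polynomial.derivative^[n] f).map (algebraMap ℝ ℂ)).eval z =
      n.factorial * (taylor z (f.map (algebraMap ℝ ℂ))).coeff n := by
  rw [← iterate_derivative_map, taylor_coeff, ← factorial_smul_hasseDeriv]
  simp

theorem eval_map_diamond (f g : ℝ[X]) {z p : ℂ} (hp : p ^ 2 = z * (z + 1)) :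
    ((diamond f g).map (algebraMap ℝ ℂ)).eval z =
      ∑ n ∈ Finset.range (f.natDegree + 1),
        ((taylor z (f.map (algebraMap ℝ ℂ))).comp (C p * X)).coeff n *
          ((taylor z (g.map (algebraMap ℝ ℂ))).comp (C p * X)).coeff n := by
  rw [diamond, Polynomial.map_sum, eval_finsetSum]
  refine Finset.sum_congr rfl fun n _ => ?_
  have hn : (n.factorial : ℂ) ≠ 0 := Nat.cast_ne_zero.mpr n.factorial_ne_zero
  simp only [Polynomial.map_mul, eval_mul, eval_map_iterate_derivative, comp_C_mul_X_coeff,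
    Polynomial.map_pow, eval_pow, Polynomial.map_add, Polynomial.map_X, Polynomial.map_one,
    eval_add, eval_X, eval_one, map_C, eval_C]
  rw [← hp]
  simp only [Complex.coe_algebraMap, Complex.ofReal_inv, Complex.ofReal_mul, Complex.ofReal_natCast]
  field_simp
  ring

/-- **Wagner's theorem.** If all complex zeros of `f` and `g` lie in `[-1,0]`, then all
complex zeros of `f ◇ g` lie in `[-1,0]`. -/
theorem diamond_interval_rooted (f g : Polynomial ℝ)
    (hf : IntervalRooted f) (hg : IntervalRooted g) :
    ∀ z : ℂ, ((diamond f g).map (algebraMap ℝ ℂ)).IsRoot z →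
      z.im = 0 ∧ -1 ≤ z.re ∧ z.re ≤ 0 := by
  intro z hroot
  by_contra hz
  obtain ⟨r, hr, hrz⟩ := exists_sq_mul_add_one_eq hz
  have hF := hf.hurwitzStable hr hrz
  have hp : (r * (z + 1)) ^ 2 = z * (z + 1) := by linear_combination (z + 1) * hrz
  have hp0 : r * (z + 1) ≠ 0 := by
    intro h
    rw [h, zero_pow two_ne_zero] at hp
    rcases mul_eq_zero.mp hp.symm with h0 | h1
    · exact hz (by simp [h0])
    · exact hz (by simp [eq_neg_of_add_eq_zero_left h1])
  have hdeg : ((taylor z (f.map (algebraMap ℝ ℂ))).comp (C (r * (z + 1)) * X)).natDegree =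
      f.natDegree := by
    rw [natDegree_comp, natDegree_C_mul_X _ hp0, natDegree_taylor, mul_one, natDegree_map]
  refine hF.sum_coeff_mul_coeff_ne_zero (hg.hurwitzStable hr hrz) ?_
  rw [hdeg, ← eval_map_diamond f g hp]
  exact hroot
end

section
/- Let f = aₘxᵐ + a_{m+1}x^{m+1} + ⋯ + aₙxⁿ be a real-rooted real polynomial with aₘaₙ ≠ 0 (m ≤ n). Then the coefficient sequence is strictly log-concave on its support: aᵢ² > a_{i−1}a_{i+1} for all m+1 ≤ i ≤ n−1. -/
open Polynomial

/-- A real polynomial is real-rooted if it is nonzero and all of its complex zeros are real. -/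
def RealRooted (f : Polynomial ℝ) : Prop :=
  f ≠ 0 ∧ ∀ z : ℂ, (f.map (algebraMap ℝ ℂ)).IsRoot z → z.im = 0

theorem RealRooted.splits {f : ℝ[X]} (hf : RealRooted f) : f.Splits := by
  refine (IsAlgClosed.splits (f.map (algebraMap ℝ ℂ))).of_splits_map _ fun z hz ↦ ?_
  have hz0 := hf.2 z (isRoot_of_mem_roots hz)
  exact ⟨z.re, Complex.ext (by simp) (by simp [hz0])⟩

/-- By Rolle's theorem, the derivative of a real polynomial that splits again splits. -/
theorem Polynomial.Splits.derivative_real {f : ℝ[X]} (hf : f.Splits) :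
    (derivative f).Splits := by
  rw [splits_iff_card_roots] at hf ⊢
  have h₁ := card_roots_le_derivative f
  have h₂ := card_roots' (derivative f)
  have h₃ := natDegree_derivative_le f
  omega

theorem Polynomial.Splits.iterate_derivative_real {f : ℝ[X]} (hf : f.Splits) (k : ℕ) :
    (derivative^[k] f).Splits := by
  induction k with
  | zero => exact hf
  | succ k ih =>
    rw [Function.iterate_succ_apply']
    exact ih.derivative_real

/-- The Laguerre inequality at `0`, with its strict form. -/
theorem Polynomial.Splits.two_mul_coeff_zero_mul_coeff_two {g : ℝ[X]} (hg : g.Splits) :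
    2 * g.coeff 0 * g.coeff 2 ≤ g.coeff 1 ^ 2 ∧
      (g.coeff 0 ≠ 0 → 0 < g.natDegree → 2 * g.coeff 0 * g.coeff 2 < g.coeff 1 ^ 2) := by
  induction hg using Submonoid.closure_induction_left with
  | one => simp [coeff_one]
  | mul_left p hp h _ ih =>
    rcases hp with ⟨a, rfl⟩ | ⟨a, rfl⟩
    · simp only [coeff_C_mul]
      refine ⟨by nlinarith [mul_nonneg (sq_nonneg a) (sub_nonneg.2 ih.1)], fun h0 hd ↦ ?_⟩
      have ha : a ≠ 0 := left_ne_zero_of_mul h0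
      rw [natDegree_C_mul ha] at hd
      have hlt := ih.2 (right_ne_zero_of_mul h0) hd
      nlinarith [mul_pos (pow_pos (abs_pos.2 ha) 2) (sub_pos.2 hlt), sq_abs a]
    · have h₀ : ((X + C a) * h).coeff 0 = a * h.coeff 0 := by simp [add_mul]
      have h₁ : ((X + C a) * h).coeff 1 = h.coeff 0 + a * h.coeff 1 := by
        simp [add_mul, coeff_X_mul h 0]
      have h₂ : ((X + C a) * h).coeff 2 = h.coeff 1 + a * h.coeff 2 := by
        simp [add_mul, coeff_X_mul h 1]
      rw [h₀, h₁, h₂]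
      have hnonneg := mul_nonneg (sq_nonneg a) (sub_nonneg.2 ih.1)
      refine ⟨by nlinarith [sq_nonneg (h.coeff 0)], fun h0 _ ↦ ?_⟩
      have hpos : 0 < h.coeff 0 ^ 2 := sq_pos_of_ne_zero (right_ne_zero_of_mul h0)
      nlinarith

/-- A strict Newton-type inequality for the coefficients of a real polynomial that splits. -/
theorem Polynomial.Splits.coeff_newton_lt {f : ℝ[X]} (hf : f.Splits) {k : ℕ}
    (hk : f.coeff k ≠ 0) (hkn : k < f.natDegree) :
    (k + 2 : ℝ) * (f.coeff k * f.coeff (k + 2)) < (k + 1) * f.coeff (k + 1) ^ 2 := by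
  have hg := (hf.iterate_derivative_real k).two_mul_coeff_zero_mul_coeff_two.2
  have hfac : (0 : ℝ) < k.factorial := by exact_mod_cast k.factorial_pos
  have d₁ : (1 + k).descFactorial k = (k + 1) * k.factorial := by
    have := Nat.factorial_mul_descFactorial (show k ≤ 1 + k by omega)
    rw [Nat.add_sub_cancel] at this
    simpa [add_comm 1 k, Nat.factorial_succ] using this
  have d₂ : 2 * (2 + k).descFactorial k = (k + 2) * ((k + 1) * k.factorial) := by
    have := Nat.factorial_mul_descFactorial (show k ≤ 2 + k by omega)
    rw [Nat.add_sub_cancel] at this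
    simpa [add_comm 2 k, Nat.factorial_succ] using this
  have c₀ : (derivative^[k] f).coeff 0 = k.factorial * f.coeff k := by
    simp [coeff_iterate_derivative, Nat.descFactorial_self]
  have c₁ : (derivative^[k] f).coeff 1 = (k + 1) * k.factorial * f.coeff (k + 1) := by
    rw [coeff_iterate_derivative, d₁, add_comm 1 k]
    simp
  have c₂ : 2 * (derivative^[k] f).coeff 2 =
      (k + 2) * ((k + 1) * k.factorial) * f.coeff (k + 2) := by
    rw [coeff_iterate_derivative, add_comm 2 k, nsmul_eq_mul, ← mul_assoc]
    rw [add_comm 2 k] at d₂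
    congr 1
    exact_mod_cast d₂
  have hdeg : 0 < (derivative^[k] f).natDegree := by
    refine (Nat.sub_pos_of_lt hkn).trans_le (le_natDegree_of_ne_zero ?_)
    rw [coeff_iterate_derivative, Nat.sub_add_cancel hkn.le, nsmul_eq_mul]
    refine mul_ne_zero (Nat.cast_ne_zero.2 (Nat.descFactorial_pos.2 hkn.le).ne') ?_
    exact leadingCoeff_ne_zero.2 fun h ↦ hk (by simp [h])
  have hlt := hg (by rw [c₀]; exact mul_ne_zero hfac.ne' hk) hdeg
  rw [mul_comm 2, mul_assoc, c₂, c₀, c₁] at hlt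
  have hpos : (0 : ℝ) < (k + 1) * (k.factorial : ℝ) ^ 2 := by positivity
  refine lt_of_mul_lt_mul_left ?_ hpos.le
  linarith

/-- Above its lowest term and below its degree, a real polynomial that splits has no two
consecutive vanishing coefficients. -/
theorem Polynomial.Splits.coeff_succ_ne_zero {f : ℝ[X]} (hf : f.Splits) {m k : ℕ}
    (hm : f.coeff m ≠ 0) (hmk : m ≤ k) (hk : k < f.natDegree) (h0 : f.coeff k = 0) :
    f.coeff (k + 1) ≠ 0 := by
  induction k, hmk using Nat.le_induction with
  | base => exact absurd h0 hm
  | succ k _ ih =>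
    intro h2
    have hlt := hf.coeff_newton_lt (fun h ↦ ih (by omega) h h0) (show k < f.natDegree by omega)
    simp [h0, h2] at hlt

/-- **Strict log-concavity of coefficients.** If `f = aₘxᵐ + ⋯ + aₙxⁿ` is real-rooted with
`aₘ aₙ ≠ 0`, then `aᵢ² > a_{i−1} a_{i+1}` for `m + 1 ≤ i ≤ n − 1`. -/
theorem coeff_strictly_log_concave (f : Polynomial ℝ) (m n : ℕ) (hmn : m ≤ n)
    (hf : RealRooted f) (hdeg : f.natDegree = n)
    (hm : f.coeff m ≠ 0) (hn : f.coeff n ≠ 0)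
    (hlow : ∀ i, i < m → f.coeff i = 0) :
    ∀ i, m + 1 ≤ i → i + 1 ≤ n →
      f.coeff (i - 1) * f.coeff (i + 1) < (f.coeff i) ^ 2 := by
  rintro i hi hin
  obtain ⟨k, rfl⟩ : ∃ k, i = k + 1 := ⟨i - 1, by omega⟩
  rw [Nat.add_sub_cancel]
  by_cases h0 : f.coeff k = 0
  · have h1 := hf.splits.coeff_succ_ne_zero hm (by omega) (by omega) h0
    rw [h0, zero_mul]
    positivity
  · have hlt := hf.splits.coeff_newton_lt h0 (by omega)
    by_contra! hle
    have hsq := sq_nonneg (f.coeff (k + 1))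
    have hk : (0 : ℝ) ≤ k := k.cast_nonneg
    nlinarith [mul_nonneg hk (sub_nonneg.2 hle)]
end
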